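/- Let G be a 2-connected simple graph in which every cycle has length divisible by 4, with vertex bipartition {V_α, V_β}. Suppose C is a subgraph of G determined by a pair of paths which cuts G, and C is minimal with this property, i.e., no subgraph of G determined by a pair of paths which cuts G is properly contained in C. Then any two vertices of C that have degree at least 3 in G are of the same type (both in V_α or both in V_β). -/

import Mathlib

open SimpleGraph

/-- A graph has *multi-4-cycles* if every cycle has length divisible by `4`. -/
def Multi4 {V : Type*} (G : SimpleGraph V) : Prop :=
  ∀ ⦃u : V⦄ (c : G.Walk u u), c.IsCycle → 4 ∣ c.length

/-- `A` and its complement form a bipartition of `G`: every edge joins `A` (type α)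
to its complement (type β). -/
def Bipartition {V : Type*} (G : SimpleGraph V) (A : Set V) : Prop :=
  ∀ ⦃u w : V⦄, G.Adj u w → (u ∈ A ↔ w ∉ A)

/-- A graph is 2-connected: connected, at least three vertices, and no cut vertex. -/
def TwoConn {W : Type*} (G : SimpleGraph W) : Prop :=
  G.Connected ∧ (∃ a b c : W, a ≠ b ∧ a ≠ c ∧ b ≠ c) ∧
    ∀ v : W, (G.induce ({v}ᶜ : Set W)).Preconnected

/-- The set of inner vertices of a walk from `x` to `y`. -/
def innSet {W : Type*} {G : SimpleGraph W} {x y : W} (P : G.Walk x y) : Set W :=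
  {w | w ∈ P.support ∧ w ≠ x ∧ w ≠ y}

/-- A graph has no cut vertex: deleting any single vertex leaves it preconnected. -/
def NoCutVertex {W : Type*} (G : SimpleGraph W) : Prop :=
  ∀ v : W, (G.induce ({v}ᶜ : Set W)).Preconnected

/-- `B` is a block of the subgraph `H` of `G`: a maximal connected subgraph of `H`
having no cut vertex. -/
def IsBlockOf {V : Type*} (G : SimpleGraph V) (B H : G.Subgraph) : Prop :=
  B ≤ H ∧ B.coe.Connected ∧ NoCutVertex B.coe ∧
    ∀ B' : G.Subgraph, B ≤ B' → B' ≤ H → B'.coe.Connected → NoCutVertex B'.coe → B' = B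

/-- The graph `G − Int P`: for a path of length at least `2` we delete the inner
vertices of `P`; for a path of length `1` we delete the edge of `P`. -/
def removeInt {V : Type*} {G : SimpleGraph V} {x y : V} (P : G.Walk x y) : G.Subgraph :=
  ((⊤ : G.Subgraph).deleteVerts (innSet P)).deleteEdges
    (if P.length = 1 then {e | e ∈ P.edges} else (∅ : Set (Sym2 V)))

/-- The graph `G − (Int P ∪ Int Q)`: inner vertices of paths of length ≥ 2 are
deleted; for a path of length 1 its edge is deleted. -/
def removeInt2 {V : Type*} {G : SimpleGraph V} {x₁ y₁ x₂ y₂ : V}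
    (P : G.Walk x₁ y₁) (Q : G.Walk x₂ y₂) : G.Subgraph :=
  ((⊤ : G.Subgraph).deleteVerts (innSet P ∪ innSet Q)).deleteEdges
    ((if P.length = 1 then {e | e ∈ P.edges} else (∅ : Set (Sym2 V))) ∪
      (if Q.length = 1 then {e | e ∈ Q.edges} else (∅ : Set (Sym2 V))))

/-- The pair `(P, Q)` of disjoint paths *cuts* `G` (with respect to the bipartition
`{A, Aᶜ}`): each path has all inner vertices of degree 2 in `G` and endpoints of
different types of degree at least 3 in `G` (here `P` runs from its type-α endpoint
`x₁` to its type-β endpoint `y₁`, and similarly for `Q`), and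
`G − (Int P ∪ Int Q)` has exactly two components, one containing both type-α
endpoints `x₁, x₂` and the other containing both type-β endpoints `y₁, y₂`. -/
def Cuts {V : Type*} [Fintype V] [DecidableEq V] (G : SimpleGraph V)
    [DecidableRel G.Adj] (A : Set V) {x₁ y₁ x₂ y₂ : V}
    (P : G.Walk x₁ y₁) (Q : G.Walk x₂ y₂) : Prop :=
  P.IsPath ∧ Q.IsPath ∧ 1 ≤ P.length ∧ 1 ≤ Q.length ∧
  (∀ w ∈ P.support, w ∉ Q.support) ∧
  x₁ ∈ A ∧ y₁ ∉ A ∧ x₂ ∈ A ∧ y₂ ∉ A ∧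
  3 ≤ G.degree x₁ ∧ 3 ≤ G.degree y₁ ∧ 3 ≤ G.degree x₂ ∧ 3 ≤ G.degree y₂ ∧
  (∀ w ∈ innSet P, G.degree w = 2) ∧ (∀ w ∈ innSet Q, G.degree w = 2) ∧
  (removeInt2 P Q).spanningCoe.Reachable x₁ x₂ ∧
  (removeInt2 P Q).spanningCoe.Reachable y₁ y₂ ∧
  ¬ (removeInt2 P Q).spanningCoe.Reachable x₁ y₁ ∧
  (∀ w ∈ (removeInt2 P Q).verts,
    (removeInt2 P Q).spanningCoe.Reachable x₁ w ∨ (removeInt2 P Q).spanningCoe.Reachable y₁ w)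

/-- The vertex set `C` is a subgraph of `G` determined by a pair of paths which cuts
`G`: it is one of the two components of `G − (Int P ∪ Int Q)` for some pair `(P, Q)`
cutting `G`. -/
def IsDetermined {V : Type*} [Fintype V] [DecidableEq V] (G : SimpleGraph V)
    [DecidableRel G.Adj] (A : Set V) (C : Set V) : Prop :=
  ∃ (x₁ y₁ x₂ y₂ : V) (P : G.Walk x₁ y₁) (Q : G.Walk x₂ y₂), Cuts G A P Q ∧
    (C = {w ∈ (removeInt2 P Q).verts | (removeInt2 P Q).spanningCoe.Reachable x₁ w} ∨
      C = {w ∈ (removeInt2 P Q).verts | (removeInt2 P Q).spanningCoe.Reachable y₁ w})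

section

variable {V : Type*}

/-- Every edge leaving `D` is the edge from `x` to `y`. -/
def SimpleGraph.OnlyExit (H : SimpleGraph V) (D : Set V) (x y : V) : Prop :=
  ∀ p ∈ D, ∀ q ∉ D, H.Adj p q → p = x ∧ q = y

/-- The spanning subgraph of `G` whose edges are the edges of `G` inside `D`. -/
def SimpleGraph.inside (G : SimpleGraph V) (D : Set V) : SimpleGraph V where
  Adj p q := G.Adj p q ∧ p ∈ D ∧ q ∈ D
  symm := ⟨fun _ _ h => ⟨h.1.symm, h.2.2, h.2.1⟩⟩
  loopless := ⟨fun _ h => G.irrefl h.1⟩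

theorem SimpleGraph.inside_le (G : SimpleGraph V) (D : Set V) : G.inside D ≤ G := fun _ _ h => h.1

theorem Multi4.four_dvd_of_isTrail {G : SimpleGraph V} (hG : Multi4 G) (n : ℕ) :
    ∀ {u : V} (c : G.Walk u u), c.IsTrail → c.length = n → 4 ∣ n := by
  induction n using Nat.strong_induction_on with
  | _ n ih =>
    intro u c hc hn
    cases c with
    | nil => simp at hn; omega
    | cons h p =>
      rw [Walk.isTrail_cons] at hc
      by_cases hp : p.IsPath
      · rw [← hn]
        exact hG _ ((Walk.cons_isCycle_iff p h).2 ⟨hp, hc.2⟩)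
      · rw [hc.1.isPath_iff_isSubwalk_imp_not_isCycle] at hp
        push Not at hp
        obtain ⟨v, w, ⟨r, s, rfl⟩, hw⟩ := hp
        have h4 := hG _ hw
        have hw3 := hw.three_le_length
        simp only [Walk.length_cons, Walk.length_append] at hn
        have htr : (Walk.cons h (r.append s)).IsTrail := by
          rw [Walk.isTrail_cons]
          constructor
          · have h1 := hc.1.edges_nodup
            constructor
            simp only [Walk.edges_append, List.nodup_append] at h1 ⊢
            grind
          · have h2 := hc.2
            simp only [Walk.edges_append, List.mem_append] at h2 ⊢
            tauto
        have := ih (r.length + s.length + 1) (by omega) _ htr (by simp)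
        omega

theorem Bipartition.even_length_iff {G : SimpleGraph V} {A : Set V} (hb : Bipartition G A)
    {x y : V} (p : G.Walk x y) : Even p.length ↔ (x ∈ A ↔ y ∈ A) := by
  induction p with
  | nil => simp
  | cons h p ih =>
    have := hb h
    rw [Walk.length_cons, Nat.even_add_one]
    tauto

/-- Three pairwise edge-disjoint paths can only join vertices of the same type. -/
theorem Multi4.same_type_of_three_paths {G : SimpleGraph V} {A : Set V} (hG : Multi4 G)
    (hb : Bipartition G A) {x y : V} {p q r : G.Walk x y}
    (hp : p.IsPath) (hq : q.IsPath) (hr : r.IsPath)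
    (hpq : ∀ e ∈ p.edges, e ∉ q.edges) (hpr : ∀ e ∈ p.edges, e ∉ r.edges)
    (hqr : ∀ e ∈ q.edges, e ∉ r.edges) : x ∈ A ↔ y ∈ A := by
  have key : ∀ {p q : G.Walk x y}, p.IsPath → q.IsPath → (∀ e ∈ p.edges, e ∉ q.edges) →
      4 ∣ p.length + q.length := by
    intro p q hp hq h
    refine hG.four_dvd_of_isTrail _ (p.append q.reverse) ?_ (by simp)
    constructor
    have h1 := hp.isTrail.edges_nodup
    have h2 := hq.isTrail.edges_nodup
    simp only [Walk.edges_append, Walk.edges_reverse, List.nodup_append, List.nodup_reverse,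
      List.mem_reverse]
    grind
  have h1 := key hp hq hpq
  have h2 := key hp hr hpr
  have h3 := key hq hr hqr
  rw [← hb.even_length_iff p, Nat.even_iff]
  omega

/-- The case of two paths of Menger's theorem for edges. -/
theorem SimpleGraph.exists_two_edge_disjoint_paths {H : SimpleGraph V} {x : V}
    (n : ℕ) : ∀ {y : V}, H.dist x y = n →
      (∀ X : Set V, x ∈ X → y ∉ X → ∀ g g', ¬ H.OnlyExit X g g') →
      ∃ p q : H.Walk x y, p.IsPath ∧ q.IsPath ∧ ∀ e ∈ p.edges, e ∉ q.edges := by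
  classical
  induction n with
  | zero =>
    intro y hd hX
    have hr : H.Reachable x y := by
      by_contra hr
      refine hX {z | H.Reachable x z} (Reachable.refl x) hr x x ?_
      intro p hp q hq hpq
      exact absurd (Reachable.trans hp hpq.reachable) hq
    obtain rfl := hr.dist_eq_zero_iff.1 hd
    exact ⟨.nil, .nil, by simp, by simp, by simp⟩
  | succ n ih =>
    intro y hd hX
    have hr : H.Reachable x y := Reachable.of_dist_ne_zero (by omega)
    obtain ⟨p, hp⟩ := hr.symm.exists_walk_length_eq_dist
    rw [dist_comm, hd] at hp
    cases p with
    | nil => simp at hp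
    | @cons _ c _ hyc p =>
      simp only [Walk.length_cons, Nat.add_right_cancel_iff] at hp
      have hdc : H.dist x c = n := by
        apply le_antisymm
        · rw [dist_comm, ← hp]; exact dist_le p
        · obtain ⟨s, hs⟩ := (Walk.reachable p).symm.exists_walk_length_eq_dist
          have := dist_le (s.concat hyc.symm)
          rw [Walk.length_concat] at this
          omega
      have hXc : ∀ X : Set V, x ∈ X → c ∉ X → ∀ g g', ¬ H.OnlyExit X g g' := by
        intro X hx hc g g' hcut
        by_cases hy : y ∈ X
        · obtain ⟨rfl, rfl⟩ := hcut y hy c hc hyc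
          obtain ⟨d, hd1, hd2, hd3⟩ := p.reverse.exists_boundary_dart X hx hc
          obtain ⟨h1, h2⟩ := hcut _ hd2 _ hd3 d.adj
          have hys : y ∈ p.reverse.support := h1 ▸ Walk.dart_fst_mem_support_of_mem_darts _ hd1
          have h3 := dist_le (p.reverse.takeUntil y hys)
          have h4 := p.reverse.length_takeUntil_le_length hys
          rw [Walk.length_reverse] at h4
          omega
        · exact hX X hx hy g g' hcut
      obtain ⟨R₁, R₂, hR₁, hR₂, hdisj⟩ := ih hdc hXc
      -- a shortest walk avoiding the edge `cy` from `y` to one of the two paths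
      let H' := H.deleteEdges {s(c, y)}
      have hM : H'.Reachable y x := by
        by_contra hM
        refine hX {z | H'.Reachable x z} (Reachable.refl x) (fun h => hM h.symm) c y ?_
        intro p hp q hq hpq
        have : s(p, q) = s(c, y) := by
          by_contra hne
          exact hq (Reachable.trans hp (Adj.reachable (by simp [H', deleteEdges_adj, hpq, hne])))
        rcases Sym2.eq_iff.1 this with h | h
        · exact h
        · rw [h.1] at hp
          exact absurd hp.symm hM
      have hex : ∃ m, ∃ w, ∃ M : H'.Walk y w, (w ∈ R₁.support ∨ w ∈ R₂.support) ∧ M.length = m := by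
        obtain ⟨M⟩ := hM
        exact ⟨_, x, M, by simp, rfl⟩
      obtain ⟨w, M, hw, hMl⟩ := Nat.find_spec hex
      have hmin : ∀ u ∈ M.support, (u ∈ R₁.support ∨ u ∈ R₂.support) → u = w := by
        intro u hu hu'
        by_contra hne
        refine Nat.find_min hex (m := (M.takeUntil u hu).length) ?_ ⟨u, _, hu', rfl⟩
        rw [← hMl]
        exact M.length_takeUntil_lt_length hu hne
      have hwlog : ∀ R₁ R₂ : H.Walk x c, R₁.IsPath → (∀ e ∈ R₁.edges, e ∉ R₂.edges) →
          (∀ u ∈ M.support, (u ∈ R₁.support ∨ u ∈ R₂.support) → u = w) → w ∈ R₁.support →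
          ∃ p q : H.Walk x y, p.IsPath ∧ q.IsPath ∧ ∀ e ∈ p.edges, e ∉ q.edges := by
        intro R₁ R₂ hR₁ hdisj hmin hw
        have hle : H' ≤ H := deleteEdges_le _
        refine ⟨((R₁.takeUntil w hw).append (M.mapLe hle).reverse).bypass,
          (R₂.concat hyc.symm).bypass, Walk.bypass_isPath _, Walk.bypass_isPath _, ?_⟩
        intro e he he'
        have he := Walk.edges_bypass_subset_edges _ he
        have he' := Walk.edges_bypass_subset_edges _ he'
        simp only [Walk.edges_append, Walk.edges_reverse, List.mem_append, List.mem_reverse,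
          Walk.edges_mapLe_eq_edges, Walk.edges_concat, List.concat_eq_append,
          List.mem_singleton] at he he'
        rcases he with he | he
        · rcases he' with he' | rfl
          · exact hdisj e (R₁.edges_takeUntil_subset_edges hw he) he'
          · have hy : y ∈ R₁.support :=
              R₁.snd_mem_support_of_mem_edges (R₁.edges_takeUntil_subset_edges hw he)
            obtain rfl : y = w := hmin y M.start_mem_support (Or.inl hy)
            exact Walk.endpoint_notMem_support_takeUntil hR₁ hw hyc.ne'
              (Walk.fst_mem_support_of_mem_edges _ he)
        · rcases he' with he' | rfl
          · induction e using Sym2.ind with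
            | _ a b =>
              have h1 := hmin a (M.fst_mem_support_of_mem_edges he)
                (Or.inr (R₂.fst_mem_support_of_mem_edges he'))
              have h2 := hmin b (M.snd_mem_support_of_mem_edges he)
                (Or.inr (R₂.snd_mem_support_of_mem_edges he'))
              have := M.adj_of_mem_edges he
              rw [h1, h2] at this
              exact this.ne rfl
          · have := M.adj_of_mem_edges he
            simp [H', deleteEdges_adj] at this
      rcases hw with hw | hw
      · exact hwlog R₁ R₂ hR₁ hdisj hmin hw
      · exact hwlog R₂ R₁ hR₂ (fun e h h' => hdisj e h' h) (fun u hu h => hmin u hu h.symm) hw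

/-- Vertices of different types joined by a path outside `H` are separated in `H` by at most one
edge. -/
theorem Multi4.exists_onlyExit {G H : SimpleGraph V} {A : Set V} (hG : Multi4 G)
    (hb : Bipartition G A) (hle : H ≤ G) {x y : V} {r : G.Walk x y} (hr : r.IsPath)
    (hrH : ∀ e ∈ r.edges, e ∉ H.edgeSet) (hxy : ¬ (x ∈ A ↔ y ∈ A)) :
    ∃ X : Set V, x ∈ X ∧ y ∉ X ∧ ∃ g g', H.OnlyExit X g g' := by
  classical
  by_contra hcon
  push Not at hcon
  obtain ⟨p, q, hp, hq, hpq⟩ := exists_two_edge_disjoint_paths (H := H) _ rfl hcon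
  refine hxy (hG.same_type_of_three_paths hb (p := p.mapLe hle) (q := q.mapLe hle) (r := r)
    (hp.mapLe hle) (hq.mapLe hle) hr ?_ ?_ ?_)
  · simpa using hpq
  · intro e he her
    exact hrH e her (p.edges_subset_edgeSet (by simpa using he))
  · intro e he her
    exact hrH e her (q.edges_subset_edgeSet (by simpa using he))

/-- Apart from one edge of `T` at its start, all edges leaving `D` are the edge from `d`
to `d'`. -/
structure IsCutSide (G : SimpleGraph V) {a b : V} (T : G.Walk a b) (D : Set V)
    (d d' : V) : Prop where
  mem : ∀ w ∈ T.support, w ∈ D ↔ w = a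
  cut : ∀ p ∈ D, ∀ q ∉ D, G.Adj p q → s(p, q) ∉ T.edges → p = d ∧ q = d'

namespace IsCutSide

variable {G : SimpleGraph V} {a b d d' : V} {T : G.Walk a b} {D : Set V}

theorem left_mem (h : IsCutSide G T D d d') : a ∈ D :=
  (h.mem a T.start_mem_support).2 rfl

theorem disjoint_innSet (h : IsCutSide G T D d d') : ∀ w ∈ D, w ∉ innSet T :=
  fun w hw hi => hi.2.1 ((h.mem w hi.1).1 hw)

end IsCutSide

end

/-- Deleting `v` does not disconnect `S` from the other vertices outside `S`. -/
theorem TwoConn.exists_adj_of_ne {V : Type*} {G : SimpleGraph V} (h2 : TwoConn G) {v : V}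
    {S : Set V} {s z : V} (hs : s ∈ S) (hv : v ∉ S) (hz : z ∉ S) (hzv : z ≠ v) :
    ∃ p ∈ S, ∃ q ∉ S, q ≠ v ∧ G.Adj p q := by
  have hsv : s ≠ v := fun h => hv (h ▸ hs)
  obtain ⟨w⟩ := h2.2.2 v ⟨s, hsv⟩ ⟨z, hzv⟩
  obtain ⟨d, -, h1, h2⟩ := w.exists_boundary_dart {x | x.1 ∈ S} hs hz
  exact ⟨d.fst, h1, d.snd, h2, d.snd.2, d.adj⟩

/-- A 2-connected graph has no bridge. -/
theorem TwoConn.not_onlyExit {V : Type*} {G : SimpleGraph V} (h2 : TwoConn G) {S : Set V} {s z : V}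
    (hs : s ∈ S) (hz : z ∉ S) (x y : V) : ¬ G.OnlyExit S x y := by
  intro h
  obtain ⟨w⟩ := h2.1.preconnected s z
  obtain ⟨d, -, hd1, hd2⟩ := w.exists_boundary_dart S hs hz
  obtain ⟨hx, hy⟩ := h _ hd1 _ hd2 d.adj
  rw [hx] at hd1
  rw [hy] at hd2
  have hxy : x ≠ y := fun h => hd2 (h ▸ hd1)
  by_cases hS : ∃ t ∈ S, t ≠ x
  · obtain ⟨t, ht, htx⟩ := hS
    obtain ⟨p, hp, q, hq, hqx, hpq⟩ := h2.exists_adj_of_ne (v := x) (S := S \ {x}) (s := t) (z := y)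
      ⟨ht, htx⟩ (fun h => h.2 rfl) (fun h => hd2 h.1) hxy.symm
    exact hp.2 (h p hp.1 q (fun hqS => hq ⟨hqS, hqx⟩) hpq).1
  · push Not at hS
    obtain ⟨t, htx, hty⟩ : ∃ t, t ≠ x ∧ t ≠ y := by
      obtain ⟨a, b, c, hab, hac, hbc⟩ := h2.2.1
      by_contra! hcon
      by_cases ha : a = x
      · exact hbc ((hcon b (ha ▸ hab.symm)).trans (hcon c (ha ▸ hac.symm)).symm)
      · by_cases hb : b = x
        · exact hac ((hcon a ha).trans (hcon c (hb ▸ hbc.symm)).symm)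
        · exact hab ((hcon a ha).trans (hcon b hb).symm)
    obtain ⟨p, hp, q, hq, hqy, hpq⟩ := h2.exists_adj_of_ne (v := y) (S := Sᶜ \ {y}) (s := t)
      (z := x) ⟨fun h => htx (hS t h), hty⟩ (fun h => h.2 rfl) (fun h => h.1 hd1) hxy
    have hqS : q ∈ S := by
      by_contra hqS
      exact hq ⟨hqS, hqy⟩
    exact hp.2 (h q hqS p hp.1 hpq.symm).2

/-- A vertex set left by at most two edges, all of whose edges survive in `R`, is connected
in `R`. -/
theorem TwoConn.reachable_iff_mem {V : Type*} {G R : SimpleGraph V} (h2 : TwoConn G)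
    {D : Set V} {x₁ u₁ x₂ u₂ z₀ : V} (hx₁ : x₁ ∈ D) (hz₀ : z₀ ∉ D)
    (hR : ∀ p ∈ D, ∀ q, R.Adj p q → q ∈ D)
    (hG : ∀ p ∈ D, ∀ q, G.Adj p q → ¬ R.Adj p q → (p = x₁ ∧ q = u₁) ∨ (p = x₂ ∧ q = u₂)) (z : V) :
    R.Reachable x₁ z ↔ z ∈ D := by
  have hsub : ∀ {z}, R.Reachable x₁ z → z ∈ D := by
    rintro z ⟨w⟩
    by_contra hz
    obtain ⟨d, -, h1, h2⟩ := w.exists_boundary_dart D hx₁ hz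
    exact h2 (hR _ h1 _ d.adj)
  have hcl : ∀ {p q}, R.Reachable x₁ p → ¬ R.Reachable x₁ q → ¬ R.Adj p q :=
    fun hp hq hpq => hq (hp.trans hpq.reachable)
  have hx₂' : R.Reachable x₁ x₂ := by
    by_contra hcon
    refine h2.not_onlyExit (S := {z | R.Reachable x₁ z}) (Reachable.refl x₁) hcon x₁ u₁ ?_
    intro p hp q hq hpq
    rcases hG p (hsub hp) q hpq (hcl hp hq) with h | h
    · exact h
    · rw [h.1] at hp
      exact absurd hp hcon
  refine ⟨hsub, fun hz => ?_⟩
  by_contra hcon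
  refine h2.not_onlyExit (S := {z | z ∈ D ∧ ¬ R.Reachable x₁ z}) (s := z) (z := z₀) ⟨hz, hcon⟩
    (fun h => hz₀ h.1) x₁ x₁ ?_
  intro p hp q hq hpq
  by_cases hRpq : R.Adj p q
  · have : R.Reachable x₁ q := by
      by_contra hq'
      exact hq ⟨hR p hp.1 q hRpq, hq'⟩
    exact absurd (this.trans hRpq.symm.reachable) hp.2
  · rcases hG p hp.1 q hpq hRpq with h | h
    · exact absurd (h.1 ▸ Reachable.refl p) hp.2
    · exact absurd (h.1 ▸ hx₂') hp.2

section Degree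

variable {V : Type*} [Fintype V] {G : SimpleGraph V} [DecidableRel G.Adj]
  {A : Set V}

theorem SimpleGraph.degree_le_two_of_adj {x u₁ u₂ : V} (h : ∀ q, G.Adj x q → q = u₁ ∨ q = u₂) :
    G.degree x ≤ 2 := by
  classical
  rw [← card_neighborFinset_eq_degree]
  refine (Finset.card_le_card (t := {u₁, u₂}) ?_).trans Finset.card_le_two
  intro q hq
  simpa using h q (by simpa using hq)

theorem TwoConn.two_le_degree (h2 : TwoConn G) (x : V) : 2 ≤ G.degree x := by
  obtain ⟨z, hz⟩ : ∃ z, z ≠ x := by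
    obtain ⟨a, b, -, hab, -⟩ := h2.2.1
    by_contra! hcon
    exact hab ((hcon a).trans (hcon b).symm)
  by_contra hd
  have hd : (G.neighborFinset x).card ≤ 1 := by
    rw [card_neighborFinset_eq_degree]; omega
  have : Nonempty V := ⟨x⟩
  obtain ⟨y, hy⟩ := Finset.card_le_one_iff_subset_singleton.1 hd
  refine h2.not_onlyExit (S := {x}) rfl hz x y ?_
  rintro p rfl q - hpq
  exact ⟨rfl, by simpa using hy (by simpa using hpq : q ∈ G.neighborFinset p)⟩

/-- If all edges leaving `S` start at `x`, at most two of them, then `S` has no vertex of degree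
at least `3`. -/
theorem TwoConn.ne_of_exits (h2 : TwoConn G) {S : Set V} {x₁ x₂ u₁ u₂ v z : V} (hx : x₁ ∈ S)
    (hv : v ∈ S) (hdv : 3 ≤ G.degree v) (hz : z ∉ S)
    (h : ∀ p ∈ S, ∀ q ∉ S, G.Adj p q → (p = x₁ ∧ q = u₁) ∨ (p = x₂ ∧ q = u₂)) : x₁ ≠ x₂ := by
  rintro rfl
  have hS : ∀ t ∈ S, t = x₁ := by
    intro t ht
    by_contra htx
    obtain ⟨p, hp, q, hq, hqx, hpq⟩ := h2.exists_adj_of_ne (v := x₁) (S := S \ {x₁}) (s := t)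
      (z := z) ⟨ht, htx⟩ (fun h => h.2 rfl) (fun h => hz h.1) (fun h => hz (h ▸ hx))
    rcases h p hp.1 q (fun hqS => hq ⟨hqS, hqx⟩) hpq with h | h
    · exact hp.2 h.1
    · exact hp.2 h.1
  have : G.degree v ≤ 2 := by
    refine degree_le_two_of_adj (u₁ := u₁) (u₂ := u₂) fun q hq => ?_
    rcases h v hv q (fun hqS => hq.ne ((hS v hv).trans (hS q hqS).symm)) hq with h | h
    · exact Or.inl h.2
    · exact Or.inr h.2
  omega

/-- A vertex set with a vertex of degree at least `3`, left by two edges at `p` and `q`, and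
such that no edge inside the set separates `p` from `q` inside the set. -/
theorem Multi4.irreducible_exits (hG : Multi4 G) (hb : Bipartition G A) (h2 : TwoConn G)
    {K : Set V} {p p' q q' v : V} (hp : p ∈ K) (hq : q ∈ K) (hp' : p' ∉ K) (hq' : q' ∉ K)
    (hpp : G.Adj p p') (hqq : G.Adj q q') (hv : v ∈ K) (hdv : 3 ≤ G.degree v)
    (hK : ∀ x ∈ K, ∀ y ∉ K, G.Adj x y → (x = p ∧ y = p') ∨ (x = q ∧ y = q'))
    (hirr : ∀ L ⊆ K, p ∈ L → q ∉ L → ∀ g g', ¬ (G.inside K).OnlyExit L g g') :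
    3 ≤ G.degree p ∧ 3 ≤ G.degree q ∧ (p ∈ A ↔ q ∈ A) := by
  classical
  have hne : p ≠ q := h2.ne_of_exits hp hv hdv hp' hK
  have hdeg : ∀ {x x'}, x ∈ K → x' ∉ K → G.Adj x x' →
      (∀ g, ¬ ∀ y ∈ K, G.Adj x y → y = g) → 3 ≤ G.degree x := by
    intro x x' hx hx' hxx h
    have h1 := h x
    push Not at h1
    obtain ⟨y, hy, hxy, -⟩ := h1
    have h3 := h y
    push Not at h3
    obtain ⟨w, hw, hxw, hwy⟩ := h3
    rw [← card_neighborFinset_eq_degree]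
    have hsub : ({x', y, w} : Finset V) ⊆ G.neighborFinset x := by
      intro t ht
      simp only [Finset.mem_insert, Finset.mem_singleton] at ht
      rcases ht with rfl | rfl | rfl <;> simpa
    refine le_trans (le_of_eq ?_) (Finset.card_le_card hsub)
    rw [Finset.card_eq_three.2]
    exact ⟨x', y, w, fun h => hx' (h ▸ hy), fun h => hx' (h ▸ hw), hwy.symm, rfl⟩
  refine ⟨hdeg hp hp' hpp fun g hg => ?_, hdeg hq hq' hqq fun g hg => ?_, ?_⟩
  · refine hirr {p} (by simpa using hp) rfl (fun h => hne h.symm) p g ?_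
    rintro x rfl y - hxy
    exact ⟨rfl, hg y hxy.2.2 hxy.1⟩
  · refine hirr (K \ {q}) Set.sdiff_subset ⟨hp, hne⟩ (fun h => h.2 rfl) g q ?_
    intro x hx y hy hxy
    obtain rfl : y = q := by
      by_contra hyq
      exact hy ⟨hxy.2.2, hyq⟩
    exact ⟨hg x hx.1 hxy.1.symm, rfl⟩
  · by_contra hpq
    have hreach : (G.inside Kᶜ).Reachable p' q' := by
      rw [h2.reachable_iff_mem (R := G.inside Kᶜ) (D := Kᶜ) (u₁ := p) (x₂ := q') (u₂ := q)
        (z₀ := p) hp' (fun h => h hp) (fun _ _ _ h => h.2.2)]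
      · exact hq'
      · intro x hx y hxy hR
        have hy : y ∈ K := by
          by_contra hy
          exact hR ⟨hxy, hx, hy⟩
        rcases hK y hy x hx hxy.symm with h | h
        · exact Or.inl h.symm
        · exact Or.inr h.symm
    obtain ⟨w⟩ := hreach
    let r : G.Walk p q := Walk.cons hpp ((w.mapLe (inside_le G Kᶜ)).concat hqq.symm)
    obtain ⟨X, hpX, hqX, g, g', hX⟩ := hG.exists_onlyExit hb (inside_le G K) (r := r.bypass)
      (Walk.bypass_isPath _) (by
        intro e he heK
        have he := Walk.edges_bypass_subset_edges _ he
        simp only [r, Walk.edges_cons, Walk.edges_concat, List.concat_eq_append, List.mem_cons,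
          List.mem_append, Walk.edges_mapLe_eq_edges, List.not_mem_nil, or_false] at he
        rcases he with rfl | he | rfl
        · exact hp' heK.2.2
        · induction e using Sym2.ind with
          | _ a b => exact (w.adj_of_mem_edges he).2.1 heK.2.1
        · exact hq' heK.2.1) hpq
    refine hirr (X ∩ K) Set.inter_subset_right ⟨hpX, hp⟩ (fun h => hqX h.1) g g' ?_
    intro x hx y hy hxy
    exact hX x hx.1 y (fun h => hy ⟨h, hxy.2.2⟩) hxy

/-- A path joining vertices of different types of degree at least `3`, whose inner vertices have
degree `2`. -/
structure IsThread (G : SimpleGraph V) [DecidableRel G.Adj] (A : Set V) {x y : V}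
    (P : G.Walk x y) : Prop where
  isPath : P.IsPath
  type : x ∈ A ↔ y ∉ A
  left : 3 ≤ G.degree x
  right : 3 ≤ G.degree y
  inner : ∀ w ∈ innSet P, G.degree w = 2

theorem innSet_reverse {W : Type*} {G : SimpleGraph W} {x y : W} (P : G.Walk x y) :
    innSet P.reverse = innSet P := by
  ext w
  simp only [innSet, Walk.support_reverse, List.mem_reverse, Set.mem_ofPred_eq]
  tauto

theorem removeInt2_reverse {W : Type*} {G : SimpleGraph W} {x₁ y₁ x₂ y₂ : W} (P : G.Walk x₁ y₁)
    (Q : G.Walk x₂ y₂) : removeInt2 P.reverse Q.reverse = removeInt2 P Q := by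
  simp [removeInt2, innSet_reverse]

namespace IsThread

variable {x y x₁ y₁ x₂ y₂ : V} {P : G.Walk x y}

theorem reverse (h : IsThread G A P) : IsThread G A P.reverse where
  isPath := h.isPath.reverse
  type := by have := h.type; tauto
  left := h.right
  right := h.left
  inner := by rw [innSet_reverse]; exact h.inner

theorem ne (h : IsThread G A P) : x ≠ y := by
  rintro rfl
  have := h.type
  tauto

theorem one_le_length (h : IsThread G A P) : 1 ≤ P.length := by
  by_contra hl
  exact h.ne (Walk.eq_of_length_eq_zero (p := P) (by omega))

theorem eq_snd (h : IsThread G A P) {q : V} (hq : s(x, q) ∈ P.edges) : q = P.snd :=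
  (h.isPath.snd_of_toSubgraph_adj (Walk.adj_toSubgraph_iff_mem_edges.2 hq)).symm

theorem mem_edges_of_adj (h : IsThread G A P) {w z : V} (hw : w ∈ innSet P) (hwz : G.Adj w z) :
    s(w, z) ∈ P.edges := by
  obtain ⟨i, rfl, hi⟩ := Walk.mem_support_iff_exists_getVert.1 hw.1
  have h0 : i ≠ 0 := by
    rintro rfl
    exact hw.2.1 (by simp)
  have hl : i < P.length := by
    refine lt_of_le_of_ne hi ?_
    rintro rfl
    exact hw.2.2 (by simp)
  have h2 := h.isPath.ncard_neighborSet_toSubgraph_internal_eq_two h0 hl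
  have hd := h.inner _ hw
  have heq : P.toSubgraph.neighborSet (P.getVert i) = G.neighborSet (P.getVert i) := by
    refine Set.eq_of_subset_of_ncard_le (Subgraph.neighborSet_subset _ _) ?_ (Set.toFinite _)
    rw [h2, ← hd, Set.ncard_eq_toFinset_card', ← card_neighborFinset_eq_degree]
    rfl
  exact Walk.adj_toSubgraph_iff_mem_edges.1 (heq.symm ▸ hwz : z ∈ P.toSubgraph.neighborSet _)

theorem length_eq_one (h : IsThread G A P) (he : s(x, y) ∈ P.edges) : P.length = 1 := by
  have hy := h.eq_snd he
  exact (h.isPath.getVert_injOn (by simpa using h.one_le_length) (by simp)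
    (by simpa using hy.symm)).symm

theorem notMem_innSet (h : IsThread G A P) {p : V} (hp : 3 ≤ G.degree p) : p ∉ innSet P :=
  fun hi => by have := h.inner p hi; omega

/-- An edge of a thread not meeting its interior is the whole thread. -/
theorem length_eq_one_of_mem_edges (h : IsThread G A P) {p q : V} (he : s(p, q) ∈ P.edges)
    (hp : p ∉ innSet P) (hq : q ∉ innSet P) : P.length = 1 := by
  have h1 := P.fst_mem_support_of_mem_edges he
  have h2 := P.snd_mem_support_of_mem_edges he
  have hne := (P.adj_of_mem_edges he).ne
  have hp' : p = x ∨ p = y := by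
    by_contra! hcon
    exact hp ⟨h1, hcon⟩
  have hq' : q = x ∨ q = y := by
    by_contra! hcon
    exact hq ⟨h2, hcon⟩
  apply h.length_eq_one
  rcases hp' with rfl | rfl <;> rcases hq' with rfl | rfl
  · exact absurd rfl hne
  · exact he
  · rwa [Sym2.eq_swap]
  · exact absurd rfl hne

theorem removeInt2_adj {P : G.Walk x₁ y₁} {Q : G.Walk x₂ y₂} (hP : IsThread G A P)
    (hQ : IsThread G A Q) (p q : V) :
    (removeInt2 P Q).spanningCoe.Adj p q ↔ G.Adj p q ∧ s(p, q) ∉ P.edges ∧ s(p, q) ∉ Q.edges := by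
  simp only [removeInt2, Subgraph.spanningCoe_adj, Subgraph.deleteEdges_adj,
    Subgraph.deleteVerts_adj, Subgraph.verts_top, Set.mem_univ, true_and, Subgraph.top_adj,
    Set.mem_union, not_or]
  have hedge : ∀ {x y : V} {P : G.Walk x y}, IsThread G A P →
      (s(p, q) ∉ (if P.length = 1 then {e | e ∈ P.edges} else (∅ : Set (Sym2 V)))) →
      p ∉ innSet P → q ∉ innSet P → s(p, q) ∉ P.edges := by
    intro x y P hP hn hp hq he
    rw [if_pos (hP.length_eq_one_of_mem_edges he hp hq)] at hn
    exact hn he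
  have hdel : ∀ {x y : V} {P : G.Walk x y}, s(p, q) ∉ P.edges →
      (s(p, q) ∉ (if P.length = 1 then {e | e ∈ P.edges} else (∅ : Set (Sym2 V)))) := by
    intro x y P hn
    split_ifs
    · exact hn
    · exact Set.notMem_empty _
  constructor
  · rintro ⟨⟨⟨h1, h2⟩, ⟨h3, h4⟩, h5⟩, h6, h7⟩
    exact ⟨h5, hedge hP h6 h1 h3, hedge hQ h7 h2 h4⟩
  · rintro ⟨h1, h2, h3⟩
    refine ⟨⟨⟨fun h => h2 (hP.mem_edges_of_adj h h1), fun h => h3 (hQ.mem_edges_of_adj h h1)⟩,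
      ⟨fun h => h2 ?_, fun h => h3 ?_⟩, h1⟩, hdel h2, hdel h3⟩
    · rw [Sym2.eq_swap]; exact hP.mem_edges_of_adj h h1.symm
    · rw [Sym2.eq_swap]; exact hQ.mem_edges_of_adj h h1.symm

end IsThread

/-- `D` is the side, at the starting vertices of the disjoint threads `P` and `Q`, of the cut
given by these threads. -/
structure IsSide (G : SimpleGraph V) [DecidableRel G.Adj] (A D : Set V) {x₁ y₁ x₂ y₂ : V}
    (P : G.Walk x₁ y₁) (Q : G.Walk x₂ y₂) : Prop where
  threadP : IsThread G A P
  threadQ : IsThread G A Q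
  disj : ∀ w ∈ P.support, w ∉ Q.support
  type : x₁ ∈ A ↔ x₂ ∈ A
  memP : ∀ w ∈ P.support, w ∈ D ↔ w = x₁
  memQ : ∀ w ∈ Q.support, w ∈ D ↔ w = x₂
  cut : ∀ p ∈ D, ∀ q ∉ D, G.Adj p q → s(p, q) ∈ P.edges ∨ s(p, q) ∈ Q.edges

/-- The other side of the cut. -/
def otherSide (D : Set V) {x₁ y₁ x₂ y₂ : V} (P : G.Walk x₁ y₁) (Q : G.Walk x₂ y₂) : Set V :=
  {z | z ∉ D ∧ z ∉ innSet P ∧ z ∉ innSet Q}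

namespace IsSide

variable {D : Set V} {x₁ y₁ x₂ y₂ : V} {P : G.Walk x₁ y₁} {Q : G.Walk x₂ y₂}

theorem swap (h : IsSide G A D P Q) : IsSide G A D Q P where
  threadP := h.threadQ
  threadQ := h.threadP
  disj w hw hw' := h.disj w hw' hw
  type := h.type.symm
  memP := h.memQ
  memQ := h.memP
  cut p hp q hq hpq := (h.cut p hp q hq hpq).symm

theorem left_mem (h : IsSide G A D P Q) : x₁ ∈ D :=
  (h.memP x₁ P.start_mem_support).2 rfl

theorem right_notMem (h : IsSide G A D P Q) : y₁ ∉ D :=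
  fun hy => h.threadP.ne ((h.memP y₁ P.end_mem_support).1 hy).symm

theorem notMem_innSet (h : IsSide G A D P Q) {z : V} (hz : z ∈ D) : z ∉ innSet P :=
  fun hi => hi.2.1 ((h.memP z hi.1).1 hz)

theorem exits (h : IsSide G A D P Q) : ∀ p ∈ D, ∀ q ∉ D, G.Adj p q →
    (p = x₁ ∧ q = P.snd) ∨ (p = x₂ ∧ q = Q.snd) := by
  intro p hp q hq hpq
  rcases h.cut p hp q hq hpq with he | he
  · obtain rfl := (h.memP p (P.fst_mem_support_of_mem_edges he)).1 hp
    exact Or.inl ⟨rfl, h.threadP.eq_snd he⟩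
  · obtain rfl := (h.memQ p (Q.fst_mem_support_of_mem_edges he)).1 hp
    exact Or.inr ⟨rfl, h.threadQ.eq_snd he⟩

theorem reverse (h : IsSide G A D P Q) : IsSide G A (otherSide D P Q) P.reverse Q.reverse := by
  have hmem : ∀ {x₁ y₁ x₂ y₂ : V} {P : G.Walk x₁ y₁} {Q : G.Walk x₂ y₂}, IsSide G A D P Q →
      ∀ w ∈ P.reverse.support, w ∈ otherSide D P Q ↔ w = y₁ := by
    intro x₁ y₁ x₂ y₂ P Q h w hw
    rw [Walk.support_reverse, List.mem_reverse] at hw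
    constructor
    · rintro ⟨h1, h2, -⟩
      by_contra hne
      exact h2 ⟨hw, fun h3 => h1 (h3 ▸ h.left_mem), hne⟩
    · rintro rfl
      exact ⟨h.right_notMem, fun hi => hi.2.2 rfl, fun hi => h.disj w hw hi.1⟩
  have hcomm : otherSide D P Q = otherSide D Q P := by
    ext z; simp only [otherSide, Set.mem_ofPred_eq]; tauto
  refine ⟨h.threadP.reverse, h.threadQ.reverse, ?_, ?_, hmem h, hcomm ▸ hmem h.swap, ?_⟩
  · simpa using h.disj
  · have h1 := h.threadP.type
    have h2 := h.threadQ.type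
    have h3 := h.type
    tauto
  · intro p hp q hq hpq
    simp only [Walk.edges_reverse, List.mem_reverse]
    rw [Sym2.eq_swap]
    by_cases hqD : q ∈ D
    · exact h.cut q hqD p hp.1 hpq.symm
    · by_cases hqP : q ∈ innSet P
      · exact Or.inl (h.threadP.mem_edges_of_adj hqP hpq.symm)
      · by_cases hqQ : q ∈ innSet Q
        · exact Or.inr (h.threadQ.mem_edges_of_adj hqQ hpq.symm)
        · exact absurd ⟨hqD, hqP, hqQ⟩ hq

theorem reachable_iff (h2 : TwoConn G) (h : IsSide G A D P Q) (z : V) :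
    (removeInt2 P Q).spanningCoe.Reachable x₁ z ↔ z ∈ D := by
  refine h2.reachable_iff_mem (G := G) (z₀ := y₁) h.left_mem h.right_notMem
    (u₁ := P.snd) (x₂ := x₂) (u₂ := Q.snd) ?_ ?_ z
  · intro p hp q hpq
    rw [h.threadP.removeInt2_adj h.threadQ] at hpq
    by_contra hq
    have := h.cut p hp q hq hpq.1
    tauto
  · intro p hp q hpq hR
    refine h.exits p hp q (fun hq => hR ?_) hpq
    rw [h.threadP.removeInt2_adj h.threadQ]
    have hne := hpq.ne
    refine ⟨hpq, fun he => hne ?_, fun he => hne ?_⟩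
    · rw [(h.memP p (P.fst_mem_support_of_mem_edges he)).1 hp,
        (h.memP q (P.snd_mem_support_of_mem_edges he)).1 hq]
    · rw [(h.memQ p (Q.fst_mem_support_of_mem_edges he)).1 hp,
        (h.memQ q (Q.snd_mem_support_of_mem_edges he)).1 hq]

theorem reachable_reverse_iff (h2 : TwoConn G) (h : IsSide G A D P Q) (z : V) :
    (removeInt2 P Q).spanningCoe.Reachable y₁ z ↔ z ∈ otherSide D P Q := by
  rw [← removeInt2_reverse]
  exact h.reverse.reachable_iff h2 z

theorem mem_verts_removeInt2 {W : Type*} {G : SimpleGraph W} {x₁ y₁ x₂ y₂ : W} {P : G.Walk x₁ y₁}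
    {Q : G.Walk x₂ y₂} {z : W} : z ∈ (removeInt2 P Q).verts ↔ z ∉ innSet P ∧ z ∉ innSet Q := by
  simp [removeInt2]

theorem component_eq (h2 : TwoConn G) (h : IsSide G A D P Q) :
    D = {w ∈ (removeInt2 P Q).verts | (removeInt2 P Q).spanningCoe.Reachable x₁ w} := by
  ext z
  simp only [Set.mem_ofPred_eq, h.reachable_iff h2, mem_verts_removeInt2]
  exact ⟨fun hz => ⟨⟨h.notMem_innSet hz, h.swap.notMem_innSet hz⟩, hz⟩, fun hz => hz.2⟩

variable [DecidableEq V]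

theorem cuts (h2 : TwoConn G) (h : IsSide G A D P Q) (hx : x₁ ∈ A) : Cuts G A P Q := by
  refine ⟨h.threadP.isPath, h.threadQ.isPath, h.threadP.one_le_length,
    h.threadQ.one_le_length, h.disj, hx,
    h.threadP.type.1 hx, h.type.1 hx, h.threadQ.type.1 (h.type.1 hx), h.threadP.left,
    h.threadP.right, h.threadQ.left, h.threadQ.right, h.threadP.inner, h.threadQ.inner,
    (h.reachable_iff h2 _).2 h.swap.left_mem,
    (h.reachable_reverse_iff h2 _).2 h.reverse.swap.left_mem,
    fun hy => h.right_notMem ((h.reachable_iff h2 _).1 hy), ?_⟩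
  intro w hw
  rw [h.reachable_iff h2, h.reachable_reverse_iff h2]
  rw [mem_verts_removeInt2] at hw
  exact or_iff_not_imp_left.2 fun hD => ⟨hD, hw⟩

theorem isDetermined (h2 : TwoConn G) (h : IsSide G A D P Q) : IsDetermined G A D := by
  by_cases hx : x₁ ∈ A
  · exact ⟨_, _, _, _, P, Q, h.cuts h2 hx, Or.inl (h.component_eq h2)⟩
  · have hy : y₁ ∈ A := by
      have := h.threadP.type
      tauto
    refine ⟨_, _, _, _, P.reverse, Q.reverse, h.reverse.cuts h2 hy, Or.inr ?_⟩
    rw [removeInt2_reverse]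
    exact h.component_eq h2

end IsSide

/-- A determined subgraph is a side of a cut. -/
theorem IsDetermined.exists_isSide [DecidableEq V] {C : Set V} (hC : IsDetermined G A C) :
    ∃ (x₁ y₁ x₂ y₂ : V) (P : G.Walk x₁ y₁) (Q : G.Walk x₂ y₂), IsSide G A C P Q := by
  have key : ∀ {x₁ y₁ x₂ y₂ : V} {P : G.Walk x₁ y₁} {Q : G.Walk x₂ y₂}, IsThread G A P →
      IsThread G A Q → (∀ w ∈ P.support, w ∉ Q.support) → (x₁ ∈ A ↔ x₂ ∈ A) →
      (removeInt2 P Q).spanningCoe.Reachable x₁ x₂ →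
      (removeInt2 P Q).spanningCoe.Reachable y₁ y₂ →
      ¬ (removeInt2 P Q).spanningCoe.Reachable x₁ y₁ →
      IsSide G A {w ∈ (removeInt2 P Q).verts | (removeInt2 P Q).spanningCoe.Reachable x₁ w}
        P Q := by
    intro x₁ y₁ x₂ y₂ P Q hP hQ hdisj ht hx hy hxy
    refine ⟨hP, hQ, hdisj, ht, ?_, ?_, ?_⟩
    · intro w hw
      simp only [Set.mem_ofPred_eq, IsSide.mem_verts_removeInt2]
      constructor
      · rintro ⟨⟨h1, -⟩, h3⟩
        by_contra hne
        refine h1 ⟨hw, hne, ?_⟩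
        rintro rfl
        exact hxy h3
      · rintro rfl
        exact ⟨⟨fun hi => hi.2.1 rfl, fun hi => hdisj w hw hi.1⟩, Reachable.refl _⟩
    · intro w hw
      simp only [Set.mem_ofPred_eq, IsSide.mem_verts_removeInt2]
      constructor
      · rintro ⟨⟨-, h1⟩, h3⟩
        by_contra hne
        refine h1 ⟨hw, hne, ?_⟩
        rintro rfl
        exact hxy (h3.trans hy.symm)
      · rintro rfl
        exact ⟨⟨fun hi => hdisj w hi.1 hw, fun hi => hi.2.1 rfl⟩, hx⟩
    · intro p hp q hq hpq
      by_contra! hcon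
      have hR := (hP.removeInt2_adj hQ p q).2 ⟨hpq, hcon⟩
      exact hq ⟨(show (removeInt2 P Q).Adj p q from hR).snd_mem, hp.2.trans hR.reachable⟩
  obtain ⟨x₁, y₁, x₂, y₂, P, Q, ⟨hP, hQ, -, -, hdisj, hx₁, hy₁, hx₂, hy₂, dx₁, dy₁, dx₂, dy₂, iP,
    iQ, rx, ry, rxy, -⟩, hC⟩ := hC
  have tP : IsThread G A P := ⟨hP, by tauto, dx₁, dy₁, iP⟩
  have tQ : IsThread G A Q := ⟨hQ, by tauto, dx₂, dy₂, iQ⟩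
  rcases hC with rfl | rfl
  · exact ⟨_, _, _, _, P, Q, key tP tQ hdisj (by tauto) rx ry rxy⟩
  · refine ⟨_, _, _, _, P.reverse, Q.reverse, ?_⟩
    rw [← removeInt2_reverse] at rx ry rxy ⊢
    exact key tP.reverse tQ.reverse (by simpa using hdisj) (by tauto) ry rx (fun h => rxy h.symm)

/-- A walk joining vertices of different types of degree at least `3` contains a thread. -/
theorem SimpleGraph.exists_isThread (h2 : TwoConn G) {R : SimpleGraph V} (hR : R ≤ G) {u v : V}
    (p : R.Walk u v) (hu : 3 ≤ G.degree u) (hv : 3 ≤ G.degree v) (huv : ¬ (u ∈ A ↔ v ∈ A)) :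
    ∃ (a b : V) (T : R.Walk a b), IsThread G A (T.mapLe hR) := by
  classical
  induction hn : p.length using Nat.strong_induction_on generalizing u v with
  | _ n ih =>
    subst hn
    by_cases hz : ∃ z ∈ innSet p.bypass, 3 ≤ G.degree z
    · obtain ⟨z, ⟨hz, hzu, hzv⟩, hd⟩ := hz
      have hle := p.length_bypass_le_length
      by_cases ht : u ∈ A ↔ z ∈ A
      · exact ih _ ((Walk.length_dropUntil_lt_length hz hzu).trans_le hle) (p.bypass.dropUntil z hz)
          hd hv (by tauto) rfl
      · exact ih _ ((Walk.length_takeUntil_lt_length hz hzv).trans_le hle) (p.bypass.takeUntil z hz)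
          hu hd ht rfl
    · push Not at hz
      refine ⟨u, v, p.bypass, p.bypass_isPath.mapLe hR, by tauto, hu, hv, fun w hw => ?_⟩
      have h1 := h2.two_le_degree w
      have h3 := hz w (by simpa only [innSet, Walk.support_mapLe_eq_support] using hw)
      omega

namespace IsCutSide

variable {a b d d' : V} {T : G.Walk a b} {D : Set V}

theorem right_notMem (h : IsCutSide G T D d d') (hT : IsThread G A T) : b ∉ D :=
  fun hb => hT.ne ((h.mem b T.end_mem_support).1 hb).symm

theorem exits (h : IsCutSide G T D d d') (hT : IsThread G A T) : ∀ p ∈ D, ∀ q ∉ D, G.Adj p q →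
    (p = a ∧ q = T.snd) ∨ (p = d ∧ q = d') := by
  intro p hp q hq hpq
  by_cases he : s(p, q) ∈ T.edges
  · obtain rfl := (h.mem p (T.fst_mem_support_of_mem_edges he)).1 hp
    exact Or.inl ⟨rfl, hT.eq_snd he⟩
  · exact Or.inr (h.cut p hp q hq hpq he)

theorem exit_spec (h : IsCutSide G T D d d') (hT : IsThread G A T) (h2 : TwoConn G) :
    d ∈ D ∧ d' ∉ D ∧ G.Adj d d' := by
  by_contra hcon
  refine h2.not_onlyExit h.left_mem (h.right_notMem hT) a T.snd fun p hp q hq hpq => ?_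
  rcases h.exits hT p hp q hq hpq with h1 | ⟨rfl, rfl⟩
  · exact h1
  · exact absurd ⟨hp, hq, hpq⟩ hcon

theorem left_ne (h : IsCutSide G T D d d') (hT : IsThread G A T) (h2 : TwoConn G) : a ≠ d :=
  h2.ne_of_exits h.left_mem h.left_mem hT.left (h.right_notMem hT) (h.exits hT)

theorem reverse (h : IsCutSide G T D d d') (hT : IsThread G A T) :
    IsCutSide G T.reverse (Dᶜ \ innSet T) d' d where
  mem w hw := by
    rw [Walk.support_reverse, List.mem_reverse] at hw
    constructor
    · rintro ⟨h1, h3⟩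
      by_contra hne
      exact h3 ⟨hw, fun ha => h1 (ha ▸ h.left_mem), hne⟩
    · rintro rfl
      exact ⟨h.right_notMem hT, fun hi => hi.2.2 rfl⟩
  cut p hp q hq hpq he := by
    rw [Walk.edges_reverse, List.mem_reverse, Sym2.eq_swap] at he
    by_cases hqD : q ∈ D
    · exact (h.cut q hqD p hp.1 hpq.symm he).symm
    · by_cases hqT : q ∈ innSet T
      · exact absurd (hT.mem_edges_of_adj hqT hpq.symm) he
      · exact absurd ⟨hqD, hqT⟩ hq

theorem right_ne (h : IsCutSide G T D d d') (hT : IsThread G A T) (h2 : TwoConn G) : b ≠ d' :=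
  (h.reverse hT).left_ne hT.reverse h2

/-- A cut side contains one whose second exit has degree at least `3` and the type of `a`. -/
theorem exists_branch (h : IsCutSide G T D d d') (hT : IsThread G A T) (hG : Multi4 G)
    (hb : Bipartition G A) (h2 : TwoConn G) :
    ∃ D₁ ⊆ D, ∃ e e', IsCutSide G T D₁ e e' ∧ 3 ≤ G.degree e ∧ (a ∈ A ↔ e ∈ A) := by
  obtain ⟨K, hK⟩ := (Set.toFinite {X | X ⊆ D ∧ ∃ e e', IsCutSide G T X e e'}).exists_minimal
    ⟨D, subset_rfl, d, d', h⟩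
  obtain ⟨hKD, e, e', hKe⟩ := hK.prop
  obtain ⟨h1, h3, h4⟩ := hKe.exit_spec hT h2
  have hnil : ¬ T.Nil := fun hn => hT.ne hn.eq
  have hsnd : T.snd ∉ K := fun hs =>
    (T.adj_snd hnil).ne ((hKe.mem _ (T.getVert_mem_support 1)).1 hs).symm
  obtain ⟨-, hde, ht⟩ := hG.irreducible_exits hb h2 hKe.left_mem h1 hsnd h3 (T.adj_snd hnil) h4
    hKe.left_mem hT.left (hKe.exits hT) fun L hL haL heL g g' hLg => heL (by
      refine hK.le_of_le ⟨hL.trans hKD, g, g', fun w hw => ?_, fun p hp q hq hpq he => ?_⟩ hL h1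
      · exact ⟨fun hwL => (hKe.mem w hw).1 (hL hwL), fun hwa => hwa ▸ haL⟩
      · by_cases hqK : q ∈ K
        · exact hLg p hp q hq ⟨hpq, hL hp, hqK⟩
        · exact absurd ((hKe.cut p (hL hp) q hqK hpq he).1 ▸ hp) heL)
  exact ⟨K, hKD, e, e', hKe, hde, ht⟩

end IsCutSide

namespace IsThread

variable {a b : V} {T : G.Walk a b}

theorem exists_isCutSide (hT : IsThread G A T) (hG : Multi4 G) (hb : Bipartition G A) :
    ∃ D d d', IsCutSide G T D d d' := by
  obtain ⟨X, ha, hbX, g, g', hX⟩ := hG.exists_onlyExit hb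
    (G.deleteEdges_le {e | e ∈ T.edges}) hT.isPath (by simp +contextual)
    (by have := hT.type; tauto)
  refine ⟨{w | w ∈ X ∧ (w ∈ T.support → w = a)}, g, g', fun w hw => ?_, fun p hp q hq hpq he => ?_⟩
  · exact ⟨fun h => h.2 hw, by rintro rfl; exact ⟨ha, fun _ => rfl⟩⟩
  · refine hX p hp.1 q (fun hqX => he ?_) (G.deleteEdges_adj.2 ⟨hpq, he⟩)
    rw [Sym2.eq_swap]
    refine hT.mem_edges_of_adj ⟨?_, ?_, fun hqb => hbX (hqb ▸ hqX)⟩ hpq.symm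
    · by_contra hqT
      exact hq ⟨hqX, fun h => absurd h hqT⟩
    · rintro rfl
      exact hq ⟨ha, fun _ => rfl⟩

/-- Two nested cut sides with no vertex of degree at least `3` between them. -/
theorem exists_isCutSide_pair (hT : IsThread G A T) (hG : Multi4 G) (hb : Bipartition G A)
    (h2 : TwoConn G) : ∃ D E d d' e e', D ⊆ E ∧ IsCutSide G T D d d' ∧ IsCutSide G T E e e' ∧
      3 ≤ G.degree d ∧ 3 ≤ G.degree e' ∧ (a ∈ A ↔ d ∈ A) ∧ (b ∈ A ↔ e' ∈ A) ∧
      ∀ v ∈ E \ D, ¬ 3 ≤ G.degree v := by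
  obtain ⟨D, hD⟩ := (Set.toFinite {X | ∃ d d', IsCutSide G T X d d' ∧ 3 ≤ G.degree d ∧
    (a ∈ A ↔ d ∈ A)}).exists_maximal (by
      obtain ⟨D, d, d', h⟩ := hT.exists_isCutSide hG hb
      obtain ⟨X, -, hX⟩ := h.exists_branch hT hG hb h2
      exact ⟨X, hX⟩)
  obtain ⟨d, d', hDd, hdd, htd⟩ := hD.prop
  obtain ⟨E, hE⟩ := (Set.toFinite {X | D ⊆ X ∧ ∃ e e', IsCutSide G T X e e' ∧ 3 ≤ G.degree e' ∧
    (b ∈ A ↔ e' ∈ A)}).exists_minimal (by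
      obtain ⟨X, hXD, e, e', hX, hde, hte⟩ := (hDd.reverse hT).exists_branch hT.reverse hG hb h2
      have hX' := hX.reverse hT.reverse
      rw [Walk.reverse_reverse, innSet_reverse] at hX'
      exact ⟨(Xᶜ \ innSet T : Set V), fun w hw => ⟨fun hwX => (hXD hwX).1 hw,
        hDd.disjoint_innSet w hw⟩, e', e, hX', hde, hte⟩)
  obtain ⟨hDE, e, e', hEe, hde, hte⟩ := hE.prop
  refine ⟨D, E, d, d', e, e', hDE, hDd, hEe, hdd, hde, htd, hte, fun v hv hdv => ?_⟩
  obtain ⟨X, hX⟩ := (Set.toFinite {X | D ⊆ X ∧ X ⊆ E ∧ v ∉ X ∧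
    ∃ x x', IsCutSide G T X x x'}).exists_maximal ⟨D, subset_rfl, hDE, hv.2, d, d', hDd⟩
  obtain ⟨hDX, hXE, hvX, x, x', hXx⟩ := hX.prop
  obtain ⟨Y, hY⟩ := (Set.toFinite {Y | X ⊆ Y ∧ Y ⊆ E ∧ v ∈ Y ∧
    ∃ y y', IsCutSide G T Y y y'}).exists_minimal ⟨E, hXE, subset_rfl, hv.1, e, e', hEe⟩
  obtain ⟨hXY, hYE, hvY, y, y', hYy⟩ := hY.prop
  obtain ⟨hx, hx', hxx⟩ := hXx.exit_spec hT h2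
  obtain ⟨hy, hy', hyy⟩ := hYy.exit_spec hT h2
  have hT' : ∀ w ∈ Y, w ∉ X → w ∉ T.support := fun w hw hwX hwT =>
    hwX ((hYy.mem w hwT).1 hw ▸ hXx.left_mem)
  have hK : ∀ p ∈ Y \ X, ∀ q ∉ Y \ X, G.Adj p q → (p = x' ∧ q = x) ∨ (p = y ∧ q = y') := by
    intro p hp q hq hpq
    have he : s(p, q) ∉ T.edges := fun he => hT' p hp.1 hp.2 (T.fst_mem_support_of_mem_edges he)
    by_cases hqX : q ∈ X
    · rw [Sym2.eq_swap] at he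
      exact Or.inl (hXx.cut q hqX p hp.2 hpq.symm he).symm
    · exact Or.inr (hYy.cut p hp.1 q (fun hqY => hq ⟨hqY, hqX⟩) hpq he)
  have hxK : x' ∈ Y \ X := by
    by_contra hcon
    refine h2.not_onlyExit (S := Y \ X) ⟨hvY, hvX⟩ (fun h => h.2 hXx.left_mem) y y'
      fun p hp q hq hpq => ?_
    rcases hK p hp q hq hpq with h | h
    · exact absurd (h.1 ▸ hp) hcon
    · exact h
  have hyK : y ∈ Y \ X := by
    by_contra hcon
    refine h2.not_onlyExit (S := Y \ X) ⟨hvY, hvX⟩ (fun h => h.2 hXx.left_mem) x' x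
      fun p hp q hq hpq => ?_
    rcases hK p hp q hq hpq with h | h
    · exact h
    · exact absurd (h.1 ▸ hp) hcon
  obtain ⟨hdx, hdy, hxy⟩ := hG.irreducible_exits hb h2 hxK hyK (fun h => h.2 hx)
    (fun h => hy' h.1) hxx.symm hyy ⟨hvY, hvX⟩ hdv hK fun L hL hxL hyL g g' hLg => by
      have hXL : IsCutSide G T (X ∪ L) g g' := by
        refine ⟨fun w hw => ⟨?_, fun h => Or.inl (h ▸ hXx.left_mem)⟩, ?_⟩
        · rintro (h | h)
          · exact (hXx.mem w hw).1 h
          · exact (hYy.mem w hw).1 (hL h).1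
        · rintro p (hp | hp) q hq hpq he
          · have hq' := (hXx.cut p hp q (fun h => hq (Or.inl h)) hpq he).2
            exact absurd (Or.inr (hq' ▸ hxL)) hq
          · by_cases hqK : q ∈ Y \ X
            · exact hLg p hp q (fun h => hq (Or.inr h)) ⟨hpq, hL hp, hqK⟩
            · rcases hK p (hL hp) q hqK hpq with h | h
              · exact absurd (Or.inl (h.2 ▸ hx)) hq
              · exact absurd (h.1 ▸ hp) hyL
      have hLY : X ∪ L ⊆ Y := Set.union_subset hXY (hL.trans Set.sdiff_subset)
      by_cases hvL : v ∈ L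
      · rcases hY.le_of_le ⟨Set.subset_union_left, hLY.trans hYE, Or.inr hvL, g, g', hXL⟩ hLY hy
          with h | h
        · exact hyK.2 h
        · exact hyL h
      · exact hxK.2 (hX.le_of_ge ⟨hDX.trans Set.subset_union_left, hLY.trans hYE,
          fun h => h.elim hvX hvL, g, g', hXL⟩ Set.subset_union_left (Or.inr hxL))
  by_cases hta : a ∈ A ↔ y ∈ A
  · exact hv.2 (hD.le_of_ge ⟨y, y', hYy, hdy, hta⟩ (hDX.trans hXY) hvY)
  · have := hT.type
    exact hvX (hE.le_of_le ⟨hDX, x, x', hXx, hdx, by tauto⟩ hXE hv.1)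

/-- Every thread is one of the two paths of a cut. -/
theorem exists_isSide (hT : IsThread G A T) (hG : Multi4 G) (hb : Bipartition G A)
    (h2 : TwoConn G) : ∃ (D : Set V) (d e : V) (W : G.Walk d e), IsSide G A D T W := by
  classical
  obtain ⟨D, E, d, d', e, e', hDE, hD, hE, hdd, hde, htd, hte, hK⟩ :=
    hT.exists_isCutSide_pair hG hb h2
  obtain ⟨hd, hd', hdd'⟩ := hD.exit_spec hT h2
  obtain ⟨he, he', hee'⟩ := hE.exit_spec hT h2
  have hTd : d ∉ T.support := fun h => hD.left_ne hT h2 ((hD.mem d h).1 hd).symm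
  have hTe : e' ∉ T.support := fun h => hT.notMem_innSet hde
    ⟨h, fun ha => he' (ha ▸ hE.left_mem), (hE.right_ne hT h2).symm⟩
  have hTK : ∀ w ∈ E \ D, w ∉ T.support := fun w hw h =>
    hw.2 ((hE.mem w h).1 hw.1 ▸ hD.left_mem)
  have hedge : s(d, d') ∉ T.edges := fun h => hTd (T.fst_mem_support_of_mem_edges h)
  obtain ⟨R, hR, hRK⟩ : ∃ R : G.Walk d' e', R.IsPath ∧ ∀ w ∈ R.support, w = e' ∨ w ∈ E \ D := by
    by_cases hdE : d' ∈ E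
    · have hreach : (G.inside (E \ D)).Reachable d' e := by
        have heD : e ∈ E \ D := by
          refine ⟨he, fun heD => ?_⟩
          have := hD.cut e heD e' (fun h => he' (hDE h)) hee'
            (fun h => hTe (T.snd_mem_support_of_mem_edges h))
          exact he' (this.2 ▸ hdE)
        rw [h2.reachable_iff_mem (R := G.inside (E \ D)) (D := E \ D) (u₁ := d) (x₂ := e)
          (u₂ := e') (z₀ := a) ⟨hdE, hd'⟩ (fun h => h.2 hD.left_mem) (fun _ _ _ h => h.2.2)]
        · exact heD
        · intro p hp q hpq hn
          have heT : s(p, q) ∉ T.edges := fun h => hTK p hp (T.fst_mem_support_of_mem_edges h)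
          by_cases hqD : q ∈ D
          · rw [Sym2.eq_swap] at heT
            exact Or.inl (hD.cut q hqD p hp.2 hpq.symm heT).symm
          · exact Or.inr (hE.cut p hp.1 q (fun hq => hn ⟨hpq, hp, hq, hqD⟩) hpq heT)
      obtain ⟨R, hR⟩ := hreach.exists_isPath
      have hRK : ∀ w ∈ R.support, w ∈ E \ D := by
        intro w hw
        by_contra hwK
        obtain ⟨x, -, h3, h4⟩ := (R.takeUntil w hw).exists_boundary_dart (E \ D) ⟨hdE, hd'⟩ hwK
        exact h4 x.adj.2.2
      refine ⟨(R.mapLe (inside_le G _)).concat hee', ?_, ?_⟩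
      · refine (hR.mapLe _).concat (fun h => he' (hRK _ ?_).1) hee'
        simpa using h
      · intro w hw
        simp only [Walk.support_concat, Walk.support_mapLe_eq_support, List.mem_append,
          List.mem_singleton] at hw
        rcases hw with hw | hw
        · exact Or.inr (hRK w hw)
        · exact Or.inl hw
    · obtain ⟨-, rfl⟩ := hE.cut d (hDE hd) d' hdE hdd' hedge
      exact ⟨Walk.nil, by simp, by simp⟩
  have hWK : ∀ w ∈ (Walk.cons hdd' R).support, w = d ∨ w = e' ∨ w ∈ E \ D := by
    intro w hw
    rw [Walk.support_cons, List.mem_cons] at hw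
    exact hw.imp_right (hRK w)
  have hWT : ∀ w ∈ T.support, w ∉ (Walk.cons hdd' R).support := by
    intro w hw hwW
    rcases hWK w hwW with rfl | rfl | h
    · exact hTd hw
    · exact hTe hw
    · exact hTK w h hw
  have heD : e' ∉ D := fun h => he' (hDE h)
  refine ⟨D, d, e', Walk.cons hdd' R, hT, ⟨?_, ?_, hdd, hde, ?_⟩, hWT, htd, hD.mem, ?_, ?_⟩
  · rw [Walk.cons_isPath_iff]
    refine ⟨hR, fun h => ?_⟩
    rcases hRK d h with rfl | h
    · exact heD hd
    · exact h.2 hd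
  · have := hT.type
    tauto
  · rintro w ⟨hw, hwd, hwe⟩
    have h1 := h2.two_le_degree w
    have h3 := hK w (((hWK w hw).resolve_left hwd).resolve_left hwe)
    omega
  · intro w hw
    refine ⟨fun hwD => ?_, fun h => h ▸ hd⟩
    rcases hWK w hw with rfl | rfl | h
    · rfl
    · exact absurd hwD heD
    · exact absurd hwD h.2
  · intro p hp q hq hpq
    by_cases h : s(p, q) ∈ T.edges
    · exact Or.inl h
    · obtain ⟨rfl, rfl⟩ := hD.cut p hp q hq hpq h
      exact Or.inr (by simp)

end IsThread

namespace IsSide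

variable {x₁ y₁ x₂ y₂ a b d e : V} {C D S : Set V} {P : G.Walk x₁ y₁} {Q : G.Walk x₂ y₂}
  {T : G.Walk a b} {W : G.Walk d e}

/-- A thread inside a side of a cut, separating the two ends of that side. -/
theorem of_thread (h : IsSide G A C P Q) (h2 : TwoConn G) (hT : IsThread G A T)
    (hTC : ∀ w ∈ T.support, w ∈ C) (hSC : S ⊆ C) (h₁ : x₁ ∈ S) (h₂ : x₂ ∉ S)
    (htype : x₁ ∈ A ↔ a ∈ A) (hmem : ∀ w ∈ T.support, w ∈ S ↔ w = a)
    (hcut : ∀ p ∈ S, ∀ q ∈ C, q ∉ S → G.Adj p q → s(p, q) ∈ T.edges) : IsSide G A S P T := by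
  have hcutS : ∀ p ∈ S, ∀ q ∉ S, G.Adj p q → s(p, q) ∈ P.edges ∨ s(p, q) ∈ T.edges := by
    intro p hp q hq hpq
    by_cases hqC : q ∈ C
    · exact Or.inr (hcut p hp q hqC hq hpq)
    · refine Or.inl ((h.cut p (hSC hp) q hqC hpq).resolve_right fun he => ?_)
      exact h₂ ((h.memQ p (Q.fst_mem_support_of_mem_edges he)).1 (hSC hp) ▸ hp)
  have hmemP : ∀ w ∈ P.support, w ∈ S ↔ w = x₁ := fun w hw =>
    ⟨fun hwS => (h.memP w hw).1 (hSC hwS), fun hwx => hwx ▸ h₁⟩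
  have hne : x₁ ≠ a := by
    refine h2.ne_of_exits (u₁ := P.snd) (u₂ := T.snd) h₁ h₁ h.threadP.left h₂ ?_
    intro p hp q hq hpq
    rcases hcutS p hp q hq hpq with he | he
    · obtain rfl := (hmemP p (P.fst_mem_support_of_mem_edges he)).1 hp
      exact Or.inl ⟨rfl, h.threadP.eq_snd he⟩
    · obtain rfl := (hmem p (T.fst_mem_support_of_mem_edges he)).1 hp
      exact Or.inr ⟨rfl, hT.eq_snd he⟩
  refine ⟨h.threadP, hT, fun w hwP hwT => hne ?_, htype, hmemP, hmem, hcutS⟩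
  obtain rfl := (h.memP w hwP).1 (hTC w hwT)
  exact (hmem w hwT).1 h₁

/-- A cut crossing a side along a thread yields a smaller side. -/
theorem exists_ssubset (h : IsSide G A C P Q) (hD : IsSide G A D T W) (h2 : TwoConn G)
    (hTC : ∀ w ∈ T.support, w ∈ C) (hd : d ∉ C) (h₁ : x₁ ∈ D) (h₂ : x₂ ∉ D) :
    ∃ (S : Set V) (u v u' v' : V) (P : G.Walk u v) (Q : G.Walk u' v'),
      S ⊂ C ∧ IsSide G A S P Q := by
  have ha := hTC a T.start_mem_support
  have hb := hTC b T.end_mem_support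
  have hcut : ∀ p ∈ D, ∀ q ∉ D, p ∈ C → G.Adj p q → s(p, q) ∈ T.edges := fun p hp q hq hpC hpq =>
    (hD.cut p hp q hq hpq).resolve_right fun he =>
      hd ((hD.memQ p (W.fst_mem_support_of_mem_edges he)).1 hp ▸ hpC)
  by_cases ht : x₁ ∈ A ↔ a ∈ A
  · refine ⟨C ∩ D, _, _, _, _, P, T,
      ⟨Set.inter_subset_left, fun hsub => hD.right_notMem (hsub hb).2⟩,
      h.of_thread h2 hD.threadP hTC Set.inter_subset_left ⟨h.left_mem, h₁⟩ (fun hx => h₂ hx.2) ht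
      (fun w hw => ⟨fun hwS => (hD.memP w hw).1 hwS.2, fun hwa => hwa ▸ ⟨ha, hD.left_mem⟩⟩) ?_⟩
    exact fun p hp q hqC hq hpq => hcut p hp.2 q (fun hqD => hq ⟨hqC, hqD⟩) hp.1 hpq
  · have hx₂ := hD.threadP.notMem_innSet h.threadQ.left
    refine ⟨(C \ D) \ innSet T, _, _, _, _, Q, T.reverse,
      ⟨fun w hw => hw.1.1, fun hsub => (hsub ha).1.2 hD.left_mem⟩,
      h.swap.of_thread h2 hD.threadP.reverse (by simpa using hTC) (fun w hw => hw.1.1)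
        ⟨⟨h.swap.left_mem, h₂⟩, hx₂⟩ (fun hx => hx.1.2 h₁) ?_ ?_ ?_⟩
    · have h3 := h.type
      have h4 := hD.threadP.type
      tauto
    · intro w hw
      rw [Walk.support_reverse, List.mem_reverse] at hw
      constructor
      · rintro ⟨⟨-, hwD⟩, hwT⟩
        by_contra hne
        exact hwT ⟨hw, fun hwa => hwD (hwa ▸ hD.left_mem), hne⟩
      · rintro rfl
        exact ⟨⟨hb, hD.right_notMem⟩, fun hi => hi.2.2 rfl⟩
    · intro p hp q hqC hq hpq
      rw [Walk.edges_reverse, List.mem_reverse, Sym2.eq_swap]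
      by_cases hqD : q ∈ D
      · exact hcut q hqD p hp.1.2 hqC hpq.symm
      · by_cases hqT : q ∈ innSet T
        · exact hD.threadP.mem_edges_of_adj hqT hpq.symm
        · exact absurd ⟨⟨hqC, hqD⟩, hqT⟩ hq

/-- A side of a cut containing a thread is not minimal. -/
theorem exists_ssubset_of_thread (h : IsSide G A C P Q) (hT : IsThread G A T) (hG : Multi4 G)
    (hbip : Bipartition G A) (h2 : TwoConn G) (hTC : ∀ w ∈ T.support, w ∈ C) :
    ∃ (S : Set V) (u v u' v' : V) (P : G.Walk u v) (Q : G.Walk u' v'),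
      S ⊂ C ∧ IsSide G A S P Q := by
  obtain ⟨D, d, e, W, hD⟩ := hT.exists_isSide hG hbip h2
  have ha := hTC a T.start_mem_support
  have hb := hTC b T.end_mem_support
  by_cases h1 : D ⊆ C
  · exact ⟨D, _, _, _, _, T, W, ⟨h1, fun hsub => hD.right_notMem (hsub hb)⟩, hD⟩
  by_cases h3 : Cᶜ ⊆ D
  · refine ⟨otherSide D T W, _, _, _, _, T.reverse, W.reverse,
      ⟨fun w hw => ?_, fun hsub => (hsub ha).1 hD.left_mem⟩, hD.reverse⟩
    by_contra hwC
    exact hw.1 (h3 hwC)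
  obtain ⟨s, hsD, hsC⟩ := Set.not_subset.1 h1
  obtain ⟨t, htC, htD⟩ := Set.not_subset.1 h3
  obtain ⟨hd, hd'⟩ : d ∉ C ∧ W.snd ∉ C := by
    by_contra hcon
    have hno : ∀ p ∈ D \ C, ∀ q, q ∉ D → q ∉ C → ¬ G.Adj p q := by
      intro p hp q hqD hqC hpq
      rcases hD.exits p hp.1 q hqD hpq with ⟨rfl, -⟩ | ⟨rfl, rfl⟩
      · exact hp.2 ha
      · exact hcon ⟨hp.2, hqC⟩
    have hex : ∀ p ∈ D \ C, ∀ q ∉ D \ C, G.Adj p q →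
        (p = P.snd ∧ q = x₁) ∨ (p = Q.snd ∧ q = x₂) := by
      intro p hp q hq hpq
      have hqC : q ∈ C := by
        by_contra hqC
        exact hno p hp q (fun hqD => hq ⟨hqD, hqC⟩) hqC hpq
      exact (h.exits q hqC p hp.2 hpq.symm).imp And.symm And.symm
    have hPD : P.snd ∈ D := by
      by_contra hP
      refine h2.not_onlyExit (S := D \ C) ⟨hsD, hsC⟩ (fun h => h.2 ha) Q.snd x₂ ?_
      intro p hp q hq hpq
      exact (hex p hp q hq hpq).resolve_left fun h => hP (h.1 ▸ hp.1)
    have hQD : Q.snd ∈ D := by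
      by_contra hQ
      refine h2.not_onlyExit (S := D \ C) ⟨hsD, hsC⟩ (fun h => h.2 ha) P.snd x₁ ?_
      intro p hp q hq hpq
      exact (hex p hp q hq hpq).resolve_right fun h => hQ (h.1 ▸ hp.1)
    refine h2.not_onlyExit (S := Cᶜ \ D) ⟨htC, htD⟩ (fun h => h.1 ha) t t ?_
    intro p hp q hq hpq
    by_cases hqC : q ∈ C
    · rcases h.exits q hqC p hp.1 hpq.symm with h | h
      · exact absurd (h.2 ▸ hPD) hp.2
      · exact absurd (h.2 ▸ hQD) hp.2
    · have hqD : q ∈ D := by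
        by_contra hqD
        exact hq ⟨hqC, hqD⟩
      exact absurd hpq.symm (hno q ⟨hqD, hqC⟩ p hp.2 hp.1)
  by_cases h₁ : x₁ ∈ D <;> by_cases h₂ : x₂ ∈ D
  · exfalso
    refine h2.not_onlyExit (S := C \ D) ⟨hb, hD.right_notMem⟩ (fun h => h.2 hD.left_mem) T.snd a ?_
    intro p hp q hq hpq
    by_cases hqC : q ∈ C
    · have hqD : q ∈ D := by
        by_contra hqD
        exact hq ⟨hqC, hqD⟩
      exact ((hD.exits q hqD p hp.2 hpq.symm).resolve_right fun h => hd (h.1 ▸ hqC)).symm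
    · rcases h.exits p hp.1 q hqC hpq with h | h
      · exact absurd (h.1 ▸ h₁) hp.2
      · exact absurd (h.1 ▸ h₂) hp.2
  · exact h.exists_ssubset hD h2 hTC hd h₁ h₂
  · exact h.swap.exists_ssubset hD h2 hTC hd h₂ h₁
  · exfalso
    refine h2.not_onlyExit (S := C ∩ D) ⟨ha, hD.left_mem⟩ (fun h => hD.right_notMem h.2 :
      b ∉ C ∩ D) a T.snd ?_
    intro p hp q hq hpq
    by_cases hqC : q ∈ C
    · exact (hD.exits p hp.2 q (fun hqD => hq ⟨hqC, hqD⟩) hpq).resolve_right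
        fun h => hd (h.1 ▸ hp.1)
    · rcases h.exits p hp.1 q hqC hpq with h | h
      · exact absurd (h.1 ▸ hp.2) h₁
      · exact absurd (h.1 ▸ hp.2) h₂

end IsSide

end Degree

/-- Theorem 2.1.  If `C` is a minimal subgraph of `G` determined by
a pair of paths which cuts `G`, then any two vertices of `C` of degree at least 3 in
`G` are of the same type. -/
theorem minimal_determined_subgraph_same_type {V : Type*} [Fintype V] [DecidableEq V]
    (G : SimpleGraph V) [DecidableRel G.Adj] (A : Set V)
    (hG : Multi4 G) (hbip : Bipartition G A) (h2 : TwoConn G)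
    (C : Set V) (hC : IsDetermined G A C)
    (hmin : ∀ C' : Set V, IsDetermined G A C' → ¬ C' ⊂ C) :
    ∀ u ∈ C, ∀ w ∈ C, 3 ≤ G.degree u → 3 ≤ G.degree w → (u ∈ A ↔ w ∈ A) := by
  intro u hu w hw hdu hdw
  by_contra hne
  obtain ⟨x₁, y₁, x₂, y₂, P, Q, h⟩ := hC.exists_isSide
  have hreach : ∀ z ∈ C, (G.inside C).Reachable x₁ z := fun z hz =>
    (h2.reachable_iff_mem (R := G.inside C) (u₁ := P.snd) (x₂ := x₂) (u₂ := Q.snd) h.left_mem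
      h.right_notMem (fun _ _ _ hpq => hpq.2.2)
      (fun p hp q hpq hn => h.exits p hp q (fun hq => hn ⟨hpq, hp, hq⟩) hpq) z).2 hz
  obtain ⟨p⟩ := (hreach u hu).symm.trans (hreach w hw)
  obtain ⟨a, b, T, hT⟩ := exists_isThread h2 (inside_le G C) p hdu hdw hne
  have hTC : ∀ z ∈ (T.mapLe (inside_le G C)).support, z ∈ C := by
    intro z hz
    rw [Walk.support_mapLe_eq_support] at hz
    obtain ⟨e, he, hze⟩ := (T.mem_support_iff_exists_mem_edges_of_not_nil
      (fun hn => hT.ne hn.eq)).1 hz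
    induction e using Sym2.ind with
    | _ s t =>
      have hst := T.adj_of_mem_edges he
      rcases Sym2.mem_iff.1 hze with rfl | rfl
      · exact hst.2.1
      · exact hst.2.2
  obtain ⟨S, _, _, _, _, _, _, hSC, hS⟩ := h.exists_ssubset_of_thread hT hG hbip h2 hTC
  exact hmin S (hS.isDetermined h2) hSC
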